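/- Let 1 < β < 2, M ≥ 2 an integer, μ₀ > 0, K > 0, ε > 0, and 0 < ν_β ≤ ν. Set A = μ₀·I + K·ν_β·G_β and R = μ₀·I + K·ν_β·r(G_β). Suppose there exist (M−1)×(M−1) real matrices U and V such that G_β − r(G_β) = U + V, rank(U) ≤ N', and the spectral norm satisfies ‖V‖₂ < (μ₀/(K·ν))·ε. Then there exist matrices Û and V̂ such that R⁻¹·A − I = Û + V̂, rank(Û) ≤ N', and ‖V̂‖₂ < ε. -/

import Mathlib

/-- Fractional centered difference coefficients `ĝ_k^{(β)}`. -/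
noncomputable def ghat (β : ℝ) (k : ℤ) : ℝ :=
  (-1 : ℝ) ^ k * Real.Gamma (β + 1) /
    (Real.Gamma (β / 2 - k + 1) * Real.Gamma (β / 2 + k + 1))

/-- The `(M−1)×(M−1)` symmetric Toeplitz matrix `G_β`. -/
noncomputable def Gmat (β : ℝ) (M : ℕ) : Matrix (Fin (M - 1)) (Fin (M - 1)) ℝ :=
  Matrix.of fun i j => ghat β ((i : ℤ) - (j : ℤ))

/-- First column of the circulant approximation `r(G_β)`. -/
noncomputable def rcol (β : ℝ) (M : ℕ) (k : ℕ) : ℝ :=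
  if k = 0 then ghat β 0 else ghat β k + ghat β ((k : ℤ) - ((M : ℤ) - 1))

/-- The `(M−1)×(M−1)` circulant matrix `r(G_β)`. -/
noncomputable def circG (β : ℝ) (M : ℕ) : Matrix (Fin (M - 1)) (Fin (M - 1)) ℝ :=
  Matrix.of fun i j => rcol β M ((((i : ℤ) - (j : ℤ)) % ((M : ℤ) - 1)).toNat)

/-- The constant `c_*^{(β)} = (2/β) r_β`. -/
noncomputable def cstar (β : ℝ) : ℝ :=
  (2 / β) * (Real.exp (-2) * ((4 - β) * (2 - β) * β) / ((6 + β) * (4 + β) * (2 + β)) *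
    (Real.Gamma (β + 1) / (Real.Gamma (β / 2 + 1)) ^ 2) * (3 + β / 2) ^ (β + 1))

/-- Grünwald coefficients `g_k^{(γ)}`. -/
noncomputable def gcoef (γ : ℝ) : ℕ → ℝ
  | 0 => 1
  | (k + 1) => (1 - (γ + 1) / (k + 1)) * gcoef γ k

/-- Weighted and shifted Grünwald coefficients `λ_k^{(γ)}`. -/
noncomputable def lamc (γ : ℝ) : ℕ → ℝ
  | 0 => 1 + γ / 2
  | (k + 1) => (1 + γ / 2) * gcoef γ (k + 1) - (γ / 2) * gcoef γ k

lemma ghat_rec (β : ℝ) (hβ1 : 1 < β) (hβ2 : β < 2) (k : ℕ) :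
    (β / 2 + (k + 1 : ℕ)) * ghat β ((k + 1 : ℕ) : ℤ) = ((k : ℝ) - β / 2) * ghat β (k : ℤ) := by
  have hk : (0 : ℝ) ≤ k := Nat.cast_nonneg k
  have h1 : β / 2 - (k : ℝ) ≠ 0 := by
    rcases Nat.eq_zero_or_pos k with h | h
    · subst h; simp; linarith
    · have : (1 : ℝ) ≤ k := by exact_mod_cast h
      intro h'; linarith
  have h2 : β / 2 + (k : ℝ) + 1 ≠ 0 := by positivity
  have e1 := Real.Gamma_add_one h1
  have e2 := Real.Gamma_add_one h2
  have h3 : Real.Gamma (β / 2 + (k : ℝ) + 1) ≠ 0 := (Real.Gamma_pos_of_pos (by positivity)).ne'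
  unfold ghat
  simp only [Int.cast_natCast, zpow_natCast]
  push_cast
  rw [show β / 2 - ((k : ℝ) + 1) + 1 = β / 2 - k by ring,
    show β / 2 + ((k : ℝ) + 1) + 1 = β / 2 + k + 1 + 1 by ring, e1, e2, pow_succ]
  by_cases hX : Real.Gamma (β / 2 - (k : ℝ)) = 0
  · simp [hX]
  have h2' : β / 2 + ((k : ℝ) + 1) ≠ 0 := by positivity
  generalize Real.Gamma (β / 2 - (k : ℝ)) = X at *
  generalize Real.Gamma (β / 2 + (k : ℝ) + 1) = Y at *
  generalize Real.Gamma (β + 1) = Z at *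
  generalize (-1 : ℝ) ^ k = W at *
  rw [mul_div_assoc', mul_div_assoc', div_eq_div_iff (by positivity) (by positivity)]
  ring

lemma ghat_zero_pos (β : ℝ) (hβ1 : 1 < β) : 0 < ghat β 0 := by
  unfold ghat
  have h1 : 0 < Real.Gamma (β + 1) := Real.Gamma_pos_of_pos (by linarith)
  have h2 : 0 < Real.Gamma (β / 2 + 1) := Real.Gamma_pos_of_pos (by linarith)
  simp
  positivity

lemma ghat_neg (β : ℝ) (k : ℤ) : ghat β (-k) = ghat β k := by
  unfold ghat
  rw [show (-1 : ℝ) ^ (-k) = (-1) ^ k by rw [zpow_neg, ← inv_zpow]; norm_num]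
  push_cast
  rw [sub_neg_eq_add, ← sub_eq_add_neg, mul_comm (Real.Gamma (β / 2 - k + 1))]

lemma ghat_nonpos (β : ℝ) (hβ1 : 1 < β) (hβ2 : β < 2) (k : ℕ) :
    ghat β ((k + 1 : ℕ) : ℤ) ≤ 0 := by
  induction k with
  | zero =>
    have h := ghat_rec β hβ1 hβ2 0
    have h0 := ghat_zero_pos β hβ1
    simp only [Nat.cast_zero] at h
    have h2 : (0 : ℝ) < β / 2 + (0 + 1 : ℕ) := by positivity
    by_contra hc
    push Not at hc
    nlinarith [mul_pos h2 hc]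
  | succ k ih =>
    have h := ghat_rec β hβ1 hβ2 (k + 1)
    have h2 : (0 : ℝ) < β / 2 + (k + 1 + 1 : ℕ) := by positivity
    have h3 : (0 : ℝ) ≤ ((k + 1 : ℕ) : ℝ) - β / 2 := by
      push_cast; have : (0 : ℝ) ≤ k := Nat.cast_nonneg k
      linarith
    by_contra hc
    push Not at hc
    nlinarith [mul_pos h2 hc, mul_nonneg h3 (neg_nonneg.2 ih)]

lemma ghat_nonpos_int (β : ℝ) (hβ1 : 1 < β) (hβ2 : β < 2) (k : ℤ) (hk : k ≠ 0) :
    ghat β k ≤ 0 := by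
  rcases lt_or_gt_of_ne hk with h | h
  · rw [← ghat_neg]
    obtain ⟨m, hm⟩ : ∃ m : ℕ, -k = ((m + 1 : ℕ) : ℤ) := ⟨(-k - 1).toNat, by omega⟩
    rw [hm]; exact ghat_nonpos β hβ1 hβ2 m
  · obtain ⟨m, hm⟩ : ∃ m : ℕ, k = ((m + 1 : ℕ) : ℤ) := ⟨(k - 1).toNat, by omega⟩
    rw [hm]; exact ghat_nonpos β hβ1 hβ2 m

lemma ghat_sum (β : ℝ) (hβ1 : 1 < β) (hβ2 : β < 2) (m : ℕ) :
    (β / 2) * (ghat β 0 + 2 * ∑ k ∈ Finset.range m, ghat β ((k + 1 : ℕ) : ℤ)) =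
      -((β / 2 + (m + 1 : ℕ)) * ghat β ((m + 1 : ℕ) : ℤ)) := by
  induction m with
  | zero =>
    rw [ghat_rec β hβ1 hβ2 0]; simp
  | succ m ih =>
    rw [Finset.sum_range_succ, ghat_rec β hβ1 hβ2 (m + 1)]
    linear_combination ih

lemma rcol_sum (β : ℝ) (hβ1 : 1 < β) (hβ2 : β < 2) (m : ℕ) :
    0 ≤ ∑ k ∈ Finset.range (m + 1), rcol β (m + 2) k := by
  have e : ∑ k ∈ Finset.range (m + 1), rcol β (m + 2) k =
      ghat β 0 + 2 * ∑ k ∈ Finset.range m, ghat β ((k + 1 : ℕ) : ℤ) := by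
    rw [Finset.sum_range_succ']
    have h1 : ∀ k ∈ Finset.range m, rcol β (m + 2) (k + 1) =
        ghat β ((k + 1 : ℕ) : ℤ) + ghat β ((m - 1 - k + 1 : ℕ) : ℤ) := by
      intro k hk
      rw [Finset.mem_range] at hk
      rw [rcol, if_neg (by omega), ← ghat_neg β ((m - 1 - k + 1 : ℕ) : ℤ)]
      congr 2
      omega
    rw [Finset.sum_congr rfl h1, Finset.sum_add_distrib,
      Finset.sum_range_reflect (fun k => ghat β ((k + 1 : ℕ) : ℤ)) m]
    simp only [rcol, if_true]
    ring
  rw [e]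
  have h := ghat_sum β hβ1 hβ2 m
  have h1 := ghat_nonpos β hβ1 hβ2 m
  have h2 : (0 : ℝ) < β / 2 + (m + 1 : ℕ) := by positivity
  have h3 : 0 < β / 2 := by linarith
  have h4 := mul_nonneg h2.le (neg_nonneg.2 h1)
  refine nonneg_of_mul_nonneg_right (a := β / 2) ?_ h3
  rw [h]; linarith

lemma circG_apply (β : ℝ) (m : ℕ) (i j : Fin (m + 1)) :
    circG β (m + 2) i j = rcol β (m + 2) ((i - j : Fin (m + 1)) : ℕ) := by
  have : ((((i : ℕ) : ℤ) - ((j : ℕ) : ℤ)) % (((m + 2 : ℕ) : ℤ) - 1)).toNat =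
      ((i - j : Fin (m + 1)) : ℕ) := by
    rw [Fin.val_sub]
    have hi := i.2
    have hj := j.2
    have e1 : (((m + 2 : ℕ) : ℤ) - 1) = ((m + 1 : ℕ) : ℤ) := by push_cast; ring
    rw [e1]
    have e2 : ((i : ℕ) : ℤ) - ((j : ℕ) : ℤ) =
      ((m + 1 - (j : ℕ) + (i : ℕ) : ℕ) : ℤ) - ((m + 1 : ℕ) : ℤ) := by omega
    rw [e2, Int.sub_emod_right, ← Int.natCast_mod, Int.toNat_natCast]
  exact congrArg (rcol β (m + 2)) this

lemma circG_quad (β : ℝ) (hβ1 : 1 < β) (hβ2 : β < 2) (m : ℕ) 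
    (C : Matrix (Fin (m + 1)) (Fin (m + 1)) ℝ)
    (hCa : ∀ i j : Fin (m + 1), C i j = rcol β (m + 2) ((i - j : Fin (m + 1)) : ℕ))
    (x : Fin (m + 1) → ℝ) :
    0 ≤ ∑ i, ∑ j, C i j * (x i * x j) := by
  have hs := rcol_sum β hβ1 hβ2 m
  rw [Finset.sum_range] at hs
  set s := ∑ k : Fin (m + 1), rcol β (m + 2) (k : ℕ) with hsdef
  have hrow : ∀ i : Fin (m + 1), ∑ j, C i j = s := by
    intro i
    simp_rw [hCa]
    exact Equiv.sum_comp (Equiv.subLeft i) (fun k : Fin (m + 1) => rcol β (m + 2) (k : ℕ))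
  have hcol : ∀ j : Fin (m + 1), ∑ i, C i j = s := by
    intro j
    simp_rw [hCa]
    exact Equiv.sum_comp (Equiv.subRight j) (fun k : Fin (m + 1) => rcol β (m + 2) (k : ℕ))
  have hle : ∀ i j : Fin (m + 1), C i j * (x i ^ 2 / 2) + C i j * (x j ^ 2 / 2) ≤
      C i j * (x i * x j) := by
    intro i j
    by_cases hij : i = j
    · subst hij; apply le_of_eq; ring
    · have : C i j ≤ 0 := by
        rw [hCa]
        have h0 : ((i - j : Fin (m + 1)) : ℕ) ≠ 0 := by
          intro h
          apply hij
          exact sub_eq_zero.1 (Fin.ext h)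
        have hlt := (i - j : Fin (m + 1)).2
        rw [rcol, if_neg h0]
        have a1 := ghat_nonpos_int β hβ1 hβ2 (((i - j : Fin (m + 1)) : ℕ) : ℤ) (by omega)
        have a2 := ghat_nonpos_int β hβ1 hβ2
          ((((i - j : Fin (m + 1)) : ℕ) : ℤ) - (((m + 2 : ℕ) : ℤ) - 1)) (by omega)
        linarith
      nlinarith [mul_nonneg (neg_nonneg.2 this) (sq_nonneg (x i - x j))]
  calc (0 : ℝ) ≤ ∑ i, s * (x i ^ 2 / 2) + ∑ j, s * (x j ^ 2 / 2) := by positivity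
    _ = ∑ i, ∑ j, (C i j * (x i ^ 2 / 2) + C i j * (x j ^ 2 / 2)) := by
      simp_rw [Finset.sum_add_distrib]
      congr 1
      · refine Finset.sum_congr rfl fun i _ => ?_
        rw [← Finset.sum_mul, hrow]
      · rw [Finset.sum_comm]
        refine Finset.sum_congr rfl fun i _ => ?_
        rw [← Finset.sum_mul, hcol]
    _ ≤ _ := Finset.sum_le_sum fun i _ => Finset.sum_le_sum fun j _ => hle i j

lemma norm_lower {n : ℕ} (C : Matrix (Fin n) (Fin n) ℝ) (μ c : ℝ) (hc : 0 ≤ c)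
    (hC : ∀ x : Fin n → ℝ, 0 ≤ ∑ i, ∑ j, C i j * (x i * x j))
    (x : EuclideanSpace ℝ (Fin n)) :
    μ * ‖x‖ ≤ ‖Matrix.toEuclideanCLM (𝕜 := ℝ) (μ • 1 + c • C) x‖ := by
  rcases eq_or_ne x 0 with rfl | hx
  · simp
  have hpos : 0 < ‖x‖ := norm_pos_iff.2 hx
  have h1 : inner ℝ x (Matrix.toEuclideanCLM (𝕜 := ℝ) C x) =
      ∑ i, ∑ j, C i j * (x i * x j) := by
    rw [PiLp.inner_apply]
    refine Finset.sum_congr rfl fun i _ => ?_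
    have : (Matrix.toEuclideanCLM (𝕜 := ℝ) C x) i = ∑ j, C i j * x j := by
      rw [Matrix.ofLp_toEuclideanCLM]; rfl
    rw [this]
    simp only [RCLike.inner_apply, conj_trivial]
    rw [Finset.sum_mul]
    exact Finset.sum_congr rfl fun j _ => by ring
  have h2 : inner ℝ x (Matrix.toEuclideanCLM (𝕜 := ℝ) (μ • 1 + c • C) x) =
      μ * ‖x‖ ^ 2 + c * ∑ i, ∑ j, C i j * (x i * x j) := by
    rw [map_add, map_smul, map_smul, map_one]
    simp only [ContinuousLinearMap.add_apply, ContinuousLinearMap.smul_apply,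
      ContinuousLinearMap.one_apply, inner_add_right, inner_smul_right, h1,
      real_inner_self_eq_norm_sq]
  have h3 := real_inner_le_norm x (Matrix.toEuclideanCLM (𝕜 := ℝ) (μ • 1 + c • C) x)
  have h4 := mul_nonneg hc (hC x)
  refine le_of_mul_le_mul_left ?_ hpos
  rw [h2] at h3
  nlinarith

/-- if `G_β − r(G_β) = U + V` with `rank U ≤ N'` and `‖V‖₂ < (μ₀/(Kν)) ε`,
then `R⁻¹ A − I = Û + V̂` with `rank Û ≤ N'` and `‖V̂‖₂ < ε`. -/
theorem stmt5 (β : ℝ) (hβ1 : 1 < β) (hβ2 : β < 2) (M : ℕ) (hM : 2 ≤ M)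
    (μ₀ K ε ν νβ : ℝ) (hμ : 0 < μ₀) (hK : 0 < K) (hε : 0 < ε)
    (hνβ : 0 < νβ) (hνν : νβ ≤ ν) (N' : ℕ)
    (U V : Matrix (Fin (M - 1)) (Fin (M - 1)) ℝ)
    (hUV : Gmat β M - circG β M = U + V)
    (hU : U.rank ≤ N')
    (hV : ‖Matrix.toEuclideanCLM (𝕜 := ℝ) V‖ < μ₀ / (K * ν) * ε) :
    let A : Matrix (Fin (M - 1)) (Fin (M - 1)) ℝ :=
      μ₀ • (1 : Matrix (Fin (M - 1)) (Fin (M - 1)) ℝ) + (K * νβ) • Gmat β M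
    let R : Matrix (Fin (M - 1)) (Fin (M - 1)) ℝ :=
      μ₀ • (1 : Matrix (Fin (M - 1)) (Fin (M - 1)) ℝ) + (K * νβ) • circG β M
    ∃ Uh Vh : Matrix (Fin (M - 1)) (Fin (M - 1)) ℝ,
      R⁻¹ * A - 1 = Uh + Vh ∧ Uh.rank ≤ N' ∧
      ‖Matrix.toEuclideanCLM (𝕜 := ℝ) Vh‖ < ε := by
  intro A R
  obtain ⟨m, rfl⟩ : ∃ m, M = m + 2 := ⟨M - 2, by omega⟩
  have hc : 0 < K * νβ := mul_pos hK hνβ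
  have hlow := norm_lower (circG β (m + 2)) μ₀ (K * νβ) hc.le (circG_quad β hβ1 hβ2 m _ (circG_apply β m))
  change ∀ x, μ₀ * ‖x‖ ≤ ‖Matrix.toEuclideanCLM (𝕜 := ℝ) R x‖ at hlow
  have hunit : IsUnit R := by
    rw [← Matrix.mulVec_injective_iff_isUnit]
    rw [← Matrix.coe_mulVecLin, ← LinearMap.ker_eq_bot, LinearMap.ker_eq_bot']
    intro x hx
    have h := hlow (WithLp.toLp 2 x)
    rw [Matrix.toEuclideanCLM_toLp] at h
    have hx' : R.mulVec x = 0 := hx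
    rw [hx'] at h
    simp only [WithLp.toLp_zero, norm_zero] at h
    have h0 : ‖WithLp.toLp 2 x‖ = 0 :=
      le_antisymm (nonpos_of_mul_nonpos_right h hμ) (norm_nonneg _)
    have h5 := norm_eq_zero.1 h0
    simpa using h5
  have hdet : IsUnit R.det := (Matrix.isUnit_iff_isUnit_det R).1 hunit
  have hA : A = R + (K * νβ) • (U + V) := by
    rw [← hUV]; simp only [A, R, smul_sub]; abel
  refine ⟨((K * νβ) • R⁻¹) * U, ((K * νβ) • R⁻¹) * V, ?_,
    (Matrix.rank_mul_le_right _ _).trans hU, ?_⟩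
  · rw [hA, mul_add, Matrix.nonsing_inv_mul _ hdet, ← mul_add, Matrix.mul_smul, Matrix.smul_mul]
    abel
  · have hbd : μ₀ * ‖Matrix.toEuclideanCLM (𝕜 := ℝ) (((K * νβ) • R⁻¹) * V)‖ ≤
        K * νβ * ‖Matrix.toEuclideanCLM (𝕜 := ℝ) V‖ := by
      rw [← le_div_iff₀' hμ]
      refine ContinuousLinearMap.opNorm_le_bound _ (by positivity) fun x => ?_
      have h := hlow (Matrix.toEuclideanCLM (𝕜 := ℝ) (((K * νβ) • R⁻¹) * V) x)
      have key : R * (((K * νβ) • R⁻¹) * V) = (K * νβ) • V := by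
        rw [← mul_assoc, Matrix.mul_smul, Matrix.mul_nonsing_inv _ hdet, Matrix.smul_mul, one_mul]
      rw [← ContinuousLinearMap.mul_apply, ← map_mul, key, map_smul,
        ContinuousLinearMap.smul_apply, norm_smul, Real.norm_of_nonneg hc.le] at h
      have h6 := (Matrix.toEuclideanCLM (𝕜 := ℝ) V).le_opNorm x
      rw [div_mul_eq_mul_div, le_div_iff₀' hμ, mul_assoc]
      exact h.trans (mul_le_mul_of_nonneg_left h6 hc.le)
    have hν : 0 < ν := hνβ.trans_le hνν
    have h7 : K * νβ * ‖Matrix.toEuclideanCLM (𝕜 := ℝ) V‖ < μ₀ * ε := by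
      calc K * νβ * ‖Matrix.toEuclideanCLM (𝕜 := ℝ) V‖
          ≤ K * ν * ‖Matrix.toEuclideanCLM (𝕜 := ℝ) V‖ := by gcongr
        _ < K * ν * (μ₀ / (K * ν) * ε) := by gcongr
        _ = μ₀ * ε := by field_simp
    exact lt_of_mul_lt_mul_left (hbd.trans_lt h7) hμ.le
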